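/- There exists a finite simple graph that admits a monotone L-representation (Mpt representation) but admits no grounded 1-string representation. -/

import Mathlib

/-- The shape of a monotone L-representation: the union of the vertical segment
from `(p, q)` to `(p, q + h)` and the horizontal segment from `(p, q)` to `(p + w, q)`. -/
def MShape (p q h w : ℝ) : Set (ℝ × ℝ) :=
  segment ℝ ((p, q) : ℝ × ℝ) ((p, q + h) : ℝ × ℝ) ∪
    segment ℝ ((p, q) : ℝ × ℝ) ((p + w, q) : ℝ × ℝ)

/-- A monotone L-representation (Mpt representation) of a simple graph `G`:
all bends lie on a common downward-sloping line. -/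
structure MptRep {V : Type} (G : SimpleGraph V) where
  p : V → ℝ
  q : V → ℝ
  ht : V → ℝ
  wd : V → ℝ
  ht_pos : ∀ v, 0 < ht v
  wd_pos : ∀ v, 0 < wd v
  line : ∃ m c : ℝ, m < 0 ∧ ∀ v, q v = m * p v + c
  p_inj : Function.Injective p
  endpoints_off : ∀ u v, u ≠ v →
    ((p v, q v + ht v) : ℝ × ℝ) ∉ MShape (p u) (q u) (ht u) (wd u) ∧
    ((p v + wd v, q v) : ℝ × ℝ) ∉ MShape (p u) (q u) (ht u) (wd u)
  adj_iff : ∀ u v, u ≠ v →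
    (G.Adj u v ↔ (MShape (p u) (q u) (ht u) (wd u) ∩ MShape (p v) (q v) (ht v) (wd v)).Nonempty)

/-- A grounded 1-string representation of a simple graph `G`:
each vertex is represented by an injective continuous curve `gam v : [0,1] → ℝ²`
starting at its anchor `(a v, 0)` on the grounding line and staying strictly below
it afterwards; distinct strings meet in at most one point, no endpoint of a string
lies on another string, and adjacency corresponds to intersection of the strings. -/
structure Grounded1StringRep {V : Type} (G : SimpleGraph V) where
  gam : V → ℝ → ℝ × ℝ
  a : V → ℝ
  cont : ∀ v, ContinuousOn (gam v) (Set.Icc 0 1)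
  inj : ∀ v, Set.InjOn (gam v) (Set.Icc 0 1)
  start : ∀ v, gam v 0 = (a v, 0)
  below : ∀ v, ∀ t ∈ Set.Ioc (0 : ℝ) 1, (gam v t).2 < 0
  a_inj : Function.Injective a
  one_string : ∀ u v, u ≠ v →
    (gam u '' Set.Icc 0 1 ∩ gam v '' Set.Icc 0 1).Subsingleton
  endpoints_off : ∀ u v, u ≠ v →
    gam v 0 ∉ gam u '' Set.Icc 0 1 ∧ gam v 1 ∉ gam u '' Set.Icc 0 1
  adj_iff : ∀ u v, u ≠ v →
    (G.Adj u v ↔ (gam u '' Set.Icc 0 1 ∩ gam v '' Set.Icc 0 1).Nonempty)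

/-- A continuous angle starting at `0` whose sine stays nonnegative remains in
`(-π / 2, 3 * π / 2)`. -/
theorem mem_Ioo_of_sin_nonneg {φ : ℝ → ℝ} (hφ : Continuous φ) (h0 : φ 0 = 0)
    (hsin : ∀ s, 0 ≤ Real.sin (φ s)) (s : ℝ) :
    φ s ∈ Set.Ioo (-(Real.pi / 2)) (3 * Real.pi / 2) := by
  have hconn : (Set.range φ).OrdConnected := (isPreconnected_range hφ).ordConnected
  have hzero : (0 : ℝ) ∈ Set.range φ := ⟨0, h0⟩
  have hpi := Real.pi_pos
  constructor
  · by_contra! h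
    obtain ⟨t, ht⟩ := hconn.out ⟨s, rfl⟩ hzero ⟨h, by linarith⟩
    have := hsin t
    rw [ht, Real.sin_neg, Real.sin_pi_div_two] at this
    linarith
  · by_contra! h
    obtain ⟨t, ht⟩ := hconn.out hzero ⟨s, rfl⟩ ⟨by linarith, h⟩
    have := hsin t
    rw [ht, show 3 * Real.pi / 2 = Real.pi / 2 + Real.pi by ring, Real.sin_add_pi,
      Real.sin_pi_div_two] at this
    linarith

theorem angle_eq_of_sin_nonneg {θ : ℝ → ℝ} (hθ : Continuous θ) (hsin : ∀ s, 0 ≤ Real.sin (θ s))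
    (h0 : Real.cos (θ 0) = 1) (h1 : Real.cos (θ 1) = 1) : θ 1 = θ 0 := by
  obtain ⟨k, hk⟩ := (Real.cos_eq_one_iff _).1 h0
  obtain ⟨n, hn⟩ := (Real.cos_eq_one_iff _).1 h1
  have h := mem_Ioo_of_sin_nonneg (φ := fun s ↦ θ s - k * (2 * Real.pi)) (by fun_prop)
    (by simp [hk]) (fun s ↦ by simpa using hsin s) 1
  have hpi := Real.pi_pos
  simp only [← hn, Set.mem_Ioo] at h
  have hlt : (n : ℝ) - k < 1 := by nlinarith
  have hgt : (-1 : ℝ) < n - k := by nlinarith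
  have : n = k := by
    have h₁ : n - k < 1 := by exact_mod_cast hlt
    have h₂ : -1 < n - k := by exact_mod_cast hgt
    omega
  rw [← hk, ← hn, this]

theorem angle_eq_add_pi_of_sin_nonneg {θ : ℝ → ℝ} (hθ : Continuous θ)
    (hsin : ∀ s, 0 ≤ Real.sin (θ s)) (h0 : Real.cos (θ 0) = 1) (h1 : Real.cos (θ 1) = -1) :
    θ 1 = θ 0 + Real.pi := by
  obtain ⟨k, hk⟩ := (Real.cos_eq_one_iff _).1 h0
  obtain ⟨n, hn⟩ := Real.cos_eq_neg_one_iff.1 h1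
  have h := mem_Ioo_of_sin_nonneg (φ := fun s ↦ θ s - k * (2 * Real.pi)) (by fun_prop)
    (by simp [hk]) (fun s ↦ by simpa using hsin s) 1
  have hpi := Real.pi_pos
  simp only [← hn, Set.mem_Ioo] at h
  have hlt : (n : ℝ) - k < 1 := by nlinarith
  have hgt : (-1 : ℝ) < n - k := by nlinarith
  have : n = k := by
    have h₁ : n - k < 1 := by exact_mod_cast hlt
    have h₂ : -1 < n - k := by exact_mod_cast hgt
    omega
  rw [← hk, ← hn, this, add_comm]

theorem cos_im_of_exp_eq_pos {z : ℂ} {x : ℝ} (hx : 0 < x) (h : Complex.exp z = x) :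
    Real.cos z.im = 1 := by
  have hre := congrArg Complex.re h
  have hn : ‖Complex.exp z‖ = x := by rw [h, Complex.norm_real, Real.norm_of_nonneg hx.le]
  rw [Complex.norm_exp] at hn
  rw [Complex.exp_re, hn, Complex.ofReal_re] at hre
  exact mul_left_cancel₀ hx.ne' (by rw [hre, mul_one])

theorem cos_im_of_exp_eq_neg {z : ℂ} {x : ℝ} (hx : x < 0) (h : Complex.exp z = x) :
    Real.cos z.im = -1 := by
  have hre := congrArg Complex.re h
  have hn : ‖Complex.exp z‖ = -x := by rw [h, Complex.norm_real, Real.norm_of_nonpos hx.le]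
  rw [Complex.norm_exp] at hn
  rw [Complex.exp_re, hn, Complex.ofReal_re] at hre
  exact mul_left_cancel₀ (neg_pos.2 hx).ne' (by rw [hre]; ring)

theorem sin_im_nonneg_iff (z : ℂ) : 0 ≤ Real.sin z.im ↔ 0 ≤ (Complex.exp z).im := by
  rw [Complex.exp_im, mul_nonneg_iff_of_pos_left (Real.exp_pos _)]

/-- Two curves in the closed lower half-plane joining `a` to `c` and `b` to `d`, where
`a < b < c < d` are real, meet. -/
theorem exists_eq_of_curves_in_lower_half_plane {α β : ℝ → ℂ} (hα : Continuous α)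
    (hβ : Continuous β) (hα' : ∀ s, (α s).im ≤ 0) (hβ' : ∀ t, (β t).im ≤ 0) {a b c d : ℝ}
    (hab : a < b) (hbc : b < c) (hcd : c < d) (hα0 : α 0 = a) (hα1 : α 1 = c)
    (hβ0 : β 0 = b) (hβ1 : β 1 = d) : ∃ s t, α s = β t := by
  by_contra! hne
  obtain ⟨G, ⟨-, hG⟩, -⟩ := Complex.isCoveringMapOn_exp.existsUnique_continuousMap_lifts
    (⟨fun x : ℝ × ℝ ↦ β x.2 - α x.1, by fun_prop⟩ : C(ℝ × ℝ, ℂ)) (a₀ := (0, 0))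
    (e₀ := Complex.log (β 0 - α 0))
    (Complex.exp_log (sub_ne_zero.2 (hne 0 0).symm)) (fun x ↦ sub_ne_zero.2 (hne x.1 x.2).symm)
  have hexp (s t : ℝ) : Complex.exp (G (s, t)) = β t - α s := congrFun hG (s, t)
  have hcos00 : Real.cos (G (0, 0)).im = 1 :=
    cos_im_of_exp_eq_pos (x := b - a) (by linarith) (by simp [hexp, hα0, hβ0])
  have hcos01 : Real.cos (G (0, 1)).im = 1 :=
    cos_im_of_exp_eq_pos (x := d - a) (by linarith) (by simp [hexp, hα0, hβ1])
  have hcos10 : Real.cos (G (1, 0)).im = -1 :=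
    cos_im_of_exp_eq_neg (x := b - c) (by linarith) (by simp [hexp, hα1, hβ0])
  have hcos11 : Real.cos (G (1, 1)).im = 1 :=
    cos_im_of_exp_eq_pos (x := d - c) (by linarith) (by simp [hexp, hα1, hβ1])
  have h1 := angle_eq_add_pi_of_sin_nonneg (θ := fun s ↦ (G (s, 0)).im) (by fun_prop)
    (fun s ↦ (sin_im_nonneg_iff _).2 (by simp [hexp, hβ0, hα' s])) hcos00 hcos10
  have h2 := angle_eq_add_pi_of_sin_nonneg (θ := fun t ↦ (G (1, t)).im + Real.pi) (by fun_prop)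
    (fun t ↦ by
      rw [Real.sin_add_pi, ← Real.sin_neg, ← Complex.neg_im, sin_im_nonneg_iff, Complex.exp_neg,
        hexp, hα1, Complex.inv_im]
      refine div_nonneg ?_ (Complex.normSq_nonneg _)
      simp [hβ' t])
    (by simp [hcos10]) (by simp [hcos11])
  have h3 := angle_eq_of_sin_nonneg (θ := fun t ↦ -(G (0, t)).im) (by fun_prop)
    (fun t ↦ by
      rw [← Complex.neg_im, sin_im_nonneg_iff, Complex.exp_neg, hexp, hα0, Complex.inv_im]
      refine div_nonneg ?_ (Complex.normSq_nonneg _)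
      simp [hβ' t])
    (by simpa using hcos00) (by simpa using hcos01)
  have h4 := angle_eq_of_sin_nonneg (θ := fun s ↦ (G (s, 1)).im) (by fun_prop)
    (fun s ↦ (sin_im_nonneg_iff _).2 (by simp [hexp, hβ1, hα' s])) hcos01 hcos11
  have hpi := Real.pi_pos
  linarith

theorem JoinedIn.exists_continuous_complex {A : Set (ℝ × ℝ)} (hA : ∀ x ∈ A, x.2 ≤ 0) {a c : ℝ}
    (h : JoinedIn A (a, 0) (c, 0)) : ∃ α : ℝ → ℂ, Continuous α ∧ (∀ s, (α s).im ≤ 0) ∧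
      α 0 = a ∧ α 1 = c ∧ ∀ s, ((α s).re, (α s).im) ∈ A := by
  have hmem (s : ℝ) : h.somePath.extend s ∈ A := h.somePath_mem _
  refine ⟨fun s ↦ Complex.equivRealProdCLM.symm (h.somePath.extend s), by fun_prop,
    fun s ↦ ?_, ?_, ?_, fun s ↦ ?_⟩
  · simpa using hA _ (hmem s)
  · simp [Complex.ext_iff]
  · simp [Complex.ext_iff]
  · simpa using hmem s

theorem inter_nonempty_of_joinedIn {A B : Set (ℝ × ℝ)} (hA : ∀ x ∈ A, x.2 ≤ 0)
    (hB : ∀ x ∈ B, x.2 ≤ 0) {a b c d : ℝ} (hab : a < b) (hbc : b < c) (hcd : c < d)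
    (hAj : JoinedIn A (a, 0) (c, 0)) (hBj : JoinedIn B (b, 0) (d, 0)) : (A ∩ B).Nonempty := by
  obtain ⟨α, hα, hα', hα0, hα1, hαA⟩ := hAj.exists_continuous_complex hA
  obtain ⟨β, hβ, hβ', hβ0, hβ1, hβB⟩ := hBj.exists_continuous_complex hB
  obtain ⟨s, t, hst⟩ := exists_eq_of_curves_in_lower_half_plane hα hβ hα' hβ' hab hbc hcd
    hα0 hα1 hβ0 hβ1
  exact ⟨_, hαA s, hst ▸ hβB t⟩

/-- The pairs of reals `{x, y}` and `{z, w}` interleave: exactly one of `z` and `w` lies strictly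
between `x` and `y`. -/
def Interleave (x y z w : ℝ) : Prop := (x - z) * (x - w) * (y - z) * (y - w) < 0

/-- Of the three ways to split four distinct reals into two pairs, one is interleaving. -/
theorem Interleave.of_not {x y z w : ℝ} (hxy : x ≠ y) (hxz : x ≠ z) (hxw : x ≠ w)
    (hyz : y ≠ z) (hyw : y ≠ w) (hzw : z ≠ w)
    (h₁ : ¬ Interleave x z y w) (h₂ : ¬ Interleave x w y z) : Interleave x y z w := by
  unfold Interleave at *
  by_contra! h
  push Not at h₁ h₂
  have hprod := mul_nonneg h (mul_nonneg h₁ h₂)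
  have hpos : 0 < ((x - y) * (x - z) * (x - w) * (y - z) * (y - w) * (z - w)) ^ 2 := by
    have := sub_ne_zero.2 hxy
    have := sub_ne_zero.2 hxz
    have := sub_ne_zero.2 hxw
    have := sub_ne_zero.2 hyz
    have := sub_ne_zero.2 hyw
    have := sub_ne_zero.2 hzw
    positivity
  linarith

theorem Interleave.cases {x y z w : ℝ} (h : Interleave x y z w) (hxy : x < y) (hzw : z < w) :
    (x < z ∧ z < y ∧ y < w) ∨ (z < x ∧ x < w ∧ w < y) := by
  unfold Interleave at h
  by_contra! hn
  refine h.not_ge ?_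
  rcases lt_or_ge x z with hxz | hxz
  · rcases lt_or_ge z y with hzy | hzy
    · have hwy := hn.1 hxz hzy
      have := mul_nonneg (mul_nonneg (sub_nonneg.2 hxz.le) (sub_nonneg.2 (hxz.trans hzw).le))
        (mul_nonneg (sub_nonneg.2 hzy.le) (sub_nonneg.2 hwy))
      linarith
    · have := mul_nonneg (mul_nonneg (sub_nonneg.2 hxz.le) (sub_nonneg.2 (hxz.trans hzw).le))
        (mul_nonneg (sub_nonneg.2 hzy) (sub_nonneg.2 (hzy.trans hzw.le)))
      linarith
  · rcases hxz.eq_or_lt with rfl | hxz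
    · simp
    rcases lt_or_ge x w with hxw | hxw
    · have hyw := hn.2 hxz hxw
      have := mul_nonneg (mul_nonneg (sub_nonneg.2 hxz.le) (sub_nonneg.2 hxw.le))
        (mul_nonneg (sub_nonneg.2 (hxz.trans hxy).le) (sub_nonneg.2 hyw))
      linarith
    · have := mul_nonneg (mul_nonneg (sub_nonneg.2 hxz.le) (sub_nonneg.2 hxw))
        (mul_nonneg (sub_nonneg.2 (hxz.trans hxy).le) (sub_nonneg.2 (hxw.trans hxy.le)))
      linarith

/-- Sets in the closed lower half-plane that join interleaving pairs of points of the boundary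
line meet. -/
theorem Interleave.inter_nonempty {A B : Set (ℝ × ℝ)} {x y z w : ℝ} (h : Interleave x y z w)
    (hA : ∀ x ∈ A, x.2 ≤ 0) (hB : ∀ x ∈ B, x.2 ≤ 0)
    (hAj : JoinedIn A (x, 0) (y, 0)) (hBj : JoinedIn B (z, 0) (w, 0)) : (A ∩ B).Nonempty := by
  wlog hxy : x < y generalizing x y
  · rcases (not_lt.1 hxy).eq_or_lt with rfl | hxy
    · refine absurd h (not_lt.2 ?_)
      nlinarith [sq_nonneg ((y - z) * (y - w))]
    · refine this ?_ hAj.symm hxy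
      unfold Interleave at h ⊢
      linarith
  wlog hzw : z < w generalizing z w
  · rcases (not_lt.1 hzw).eq_or_lt with rfl | hzw
    · refine absurd h (not_lt.2 ?_)
      nlinarith [sq_nonneg ((x - w) * (y - w))]
    · refine this hBj.symm ?_ hzw
      unfold Interleave at h ⊢
      linarith
  obtain ⟨h₁, h₂, h₃⟩ | ⟨h₁, h₂, h₃⟩ := h.cases hxy hzw
  · exact inter_nonempty_of_joinedIn hA hB h₁ h₂ h₃ hAj hBj
  · rw [Set.inter_comm]
    exact inter_nonempty_of_joinedIn hB hA h₁ h₂ h₃ hBj hAj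

namespace Grounded1StringRep

variable {V : Type} {G : SimpleGraph V} (R : Grounded1StringRep G)

/-- The string representing a vertex. -/
def string (v : V) : Set (ℝ × ℝ) := R.gam v '' Set.Icc 0 1

/-- The union of the strings of the vertices in a list. -/
def strings (l : List V) : Set (ℝ × ℝ) := {x | ∃ v ∈ l, x ∈ R.string v}

variable {R}

theorem snd_nonpos_of_mem_string {v : V} {x : ℝ × ℝ} (hx : x ∈ R.string v) : x.2 ≤ 0 := by
  obtain ⟨t, ht, rfl⟩ := hx
  rcases ht.1.eq_or_lt with rfl | h0
  · simp [R.start]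
  · exact (R.below v t ⟨h0, ht.2⟩).le

theorem anchor_mem_string (v : V) : (R.a v, 0) ∈ R.string v :=
  ⟨0, by simp, R.start v⟩

theorem gam_image_subset_string {u : V} {s : Set ℝ} (hs : s ⊆ Set.Icc 0 1) :
    R.gam u '' s ⊆ R.string u :=
  Set.image_mono hs

theorem joinedIn_gam_image (u : V) {s t : ℝ} (hs : s ∈ Set.Icc (0 : ℝ) 1)
    (ht : t ∈ Set.Icc (0 : ℝ) 1) :
    JoinedIn (R.gam u '' Set.uIcc s t) (R.gam u s) (R.gam u t) := by
  have hsub : Set.uIcc s t ⊆ Set.Icc 0 1 := Set.uIcc_subset_Icc hs ht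
  have hpath : IsPathConnected (Set.uIcc s t) :=
    (convex_uIcc s t).isPathConnected Set.nonempty_uIcc
  exact (hpath.image' ((R.cont u).mono hsub)).joinedIn _ ⟨s, Set.left_mem_uIcc, rfl⟩ _
    ⟨t, Set.right_mem_uIcc, rfl⟩

theorem joinedIn_string {v : V} {x y : ℝ × ℝ} (hx : x ∈ R.string v) (hy : y ∈ R.string v) :
    JoinedIn (R.string v) x y := by
  obtain ⟨s, hs, rfl⟩ := hx
  obtain ⟨t, ht, rfl⟩ := hy
  exact (joinedIn_gam_image v hs ht).mono (gam_image_subset_string (Set.uIcc_subset_Icc hs ht))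

theorem exists_mem_string_of_adj {u v : V} (h : G.Adj u v) :
    ∃ x, x ∈ R.string u ∧ x ∈ R.string v :=
  (R.adj_iff u v h.ne).1 h

theorem adj_of_mem_string {u v : V} (huv : u ≠ v) {x : ℝ × ℝ} (hu : x ∈ R.string u)
    (hv : x ∈ R.string v) : G.Adj u v :=
  (R.adj_iff u v huv).2 ⟨x, hu, hv⟩

/-- Along a chain of adjacent vertices, any point of the first string is joined to any point of
the last one. -/
theorem joinedIn_strings {l : List V} (hl : l.IsChain G.Adj) {u v : V} (hu : u ∈ l.head?)
    (hv : v ∈ l.getLast?) {x y : ℝ × ℝ} (hx : x ∈ R.string u) (hy : y ∈ R.string v) :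
    JoinedIn (R.strings l) x y := by
  induction l generalizing u x with
  | nil => simp at hu
  | cons w l ih =>
    obtain rfl : w = u := by simpa using hu
    have hsub : R.string w ⊆ R.strings (w :: l) := fun z hz ↦ ⟨w, by simp, hz⟩
    cases l with
    | nil =>
      obtain rfl : w = v := by simpa using hv
      exact (joinedIn_string hx hy).mono hsub
    | cons w' l =>
      rw [List.isChain_cons_cons] at hl
      obtain ⟨z, hz, hz'⟩ := exists_mem_string_of_adj (R := R) hl.1
      refine ((joinedIn_string hx hz).mono hsub).trans
        ((ih hl.2 (by simp) (by simpa using hv) hz').mono ?_)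
      rintro p ⟨q, hq, hp⟩
      exact ⟨q, List.mem_cons_of_mem _ hq, hp⟩

theorem snd_nonpos_of_mem_strings {l : List V} {x : ℝ × ℝ} (hx : x ∈ R.strings l) : x.2 ≤ 0 := by
  obtain ⟨v, -, hv⟩ := hx
  exact snd_nonpos_of_mem_string hv

/-- Disjoint chains of vertices without edges between them have non-interleaving end anchors. -/
theorem not_interleave {l l' : List V} (hl : l.IsChain G.Adj) (hl' : l'.IsChain G.Adj)
    (hne : ∀ v ∈ l, ∀ w ∈ l', v ≠ w ∧ ¬ G.Adj v w) {x y z w : V} (hx : x ∈ l.head?)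
    (hy : y ∈ l.getLast?) (hz : z ∈ l'.head?) (hw : w ∈ l'.getLast?) :
    ¬ Interleave (R.a x) (R.a y) (R.a z) (R.a w) := by
  intro h
  obtain ⟨p, ⟨v, hv, hpv⟩, v', hv', hpw⟩ := h.inter_nonempty
    (fun _ ↦ snd_nonpos_of_mem_strings) (fun _ ↦ snd_nonpos_of_mem_strings)
    (joinedIn_strings (R := R) hl hx hy (anchor_mem_string _) (anchor_mem_string _))
    (joinedIn_strings (R := R) hl' hz hw (anchor_mem_string _) (anchor_mem_string _))
  exact (hne v hv v' hv').2 (adj_of_mem_string (hne v hv v' hv').1 hpv hpw)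

/-- If the strings of `l` together with the part of the string of `u` over `s` meet the strings of
`l'`, and `u` and `x ∈ l'` are the only adjacent vertices, then the parameter at which `u` meets `x`
belongs to `s`. -/
theorem mem_of_inter_nonempty {l l' : List V} {u x : V} {s : Set ℝ} {t : ℝ}
    (hs : s ⊆ Set.Icc 0 1) (ht : t ∈ Set.Icc (0 : ℝ) 1) (htx : R.gam u t ∈ R.string x)
    (hne : ∀ v ∈ l, ∀ w ∈ l', v ≠ w ∧ ¬ G.Adj v w)
    (hu : ∀ w ∈ l', w ≠ u ∧ (G.Adj u w → w = x))
    (h : ((R.strings l ∪ R.gam u '' s) ∩ R.strings l').Nonempty) : t ∈ s := by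
  obtain ⟨p, ⟨v, hv, hpv⟩ | ⟨t', ht', rfl⟩, w, hw, hpw⟩ := h
  · exact absurd (adj_of_mem_string (hne v hv w hw).1 hpv hpw) (hne v hv w hw).2
  · have hu' : R.gam u t' ∈ R.string u := ⟨t', hs ht', rfl⟩
    obtain rfl := (hu w hw).2 (adj_of_mem_string (hu w hw).1.symm hu' hpw)
    have heq := R.one_string u w (hu w hw).1.symm ⟨hu', hpw⟩ ⟨⟨t, ht, rfl⟩, htx⟩
    rwa [← R.inj u (hs ht') ht heq]

/-- The string of `u`, followed from its anchor to its meeting point with the chain `l`, meets the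
string of `x` on the way when the end anchors interleave. -/
theorem le_of_interleave {l l' : List V} {u x y z w c : V} {t t' : ℝ}
    (hl : l.IsChain G.Adj) (hl' : l'.IsChain G.Adj)
    (hz : z ∈ l.head?) (hc : c ∈ l.getLast?) (hy : y ∈ l'.head?) (hw : w ∈ l'.getLast?)
    (hne : ∀ v ∈ l, ∀ w ∈ l', v ≠ w ∧ ¬ G.Adj v w)
    (hu : ∀ w ∈ l', w ≠ u ∧ (G.Adj u w → w = x))
    (ht : t ∈ Set.Icc (0 : ℝ) 1) (htx : R.gam u t ∈ R.string x)
    (ht' : t' ∈ Set.Icc (0 : ℝ) 1) (htc : R.gam u t' ∈ R.string c)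
    (h : Interleave (R.a y) (R.a w) (R.a z) (R.a u)) : t ≤ t' := by
  have hs : Set.uIcc t' 0 ⊆ Set.Icc 0 1 := Set.uIcc_subset_Icc ht' (by simp)
  have hmem : t ∈ Set.uIcc t' 0 := by
    refine mem_of_inter_nonempty hs ht htx hne hu ?_
    rw [Set.inter_comm]
    refine h.inter_nonempty (fun _ ↦ snd_nonpos_of_mem_strings) ?_
      (joinedIn_strings hl' hy hw (anchor_mem_string _) (anchor_mem_string _)) ?_
    · rintro p (hp | hp)
      · exact snd_nonpos_of_mem_strings hp
      · exact snd_nonpos_of_mem_string (gam_image_subset_string hs hp)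
    · refine ((joinedIn_strings hl hz hc (anchor_mem_string _) htc).mono
        Set.subset_union_left).trans ?_
      rw [← R.start u]
      exact (joinedIn_gam_image u ht' (by simp)).mono Set.subset_union_right
  rw [Set.uIcc_of_ge ht'.1] at hmem
  exact hmem.2

/-- The string of `u`, followed between its meeting points with the chains `l₁` and `l₂`, meets the
string of `x` on the way when the end anchors interleave. -/
theorem mem_uIcc_of_interleave {l₁ l₂ l' : List V} {u x y z₁ z₂ w c₁ c₂ : V} {t t₁ t₂ : ℝ}
    (hl₁ : l₁.IsChain G.Adj) (hl₂ : l₂.IsChain G.Adj) (hl' : l'.IsChain G.Adj)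
    (hz₁ : z₁ ∈ l₁.head?) (hc₁ : c₁ ∈ l₁.getLast?) (hz₂ : z₂ ∈ l₂.head?)
    (hc₂ : c₂ ∈ l₂.getLast?) (hy : y ∈ l'.head?) (hw : w ∈ l'.getLast?)
    (hne : ∀ v ∈ l₁ ++ l₂, ∀ w ∈ l', v ≠ w ∧ ¬ G.Adj v w)
    (hu : ∀ w ∈ l', w ≠ u ∧ (G.Adj u w → w = x))
    (ht : t ∈ Set.Icc (0 : ℝ) 1) (htx : R.gam u t ∈ R.string x)
    (ht₁ : t₁ ∈ Set.Icc (0 : ℝ) 1) (htc₁ : R.gam u t₁ ∈ R.string c₁)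
    (ht₂ : t₂ ∈ Set.Icc (0 : ℝ) 1) (htc₂ : R.gam u t₂ ∈ R.string c₂)
    (h : Interleave (R.a y) (R.a w) (R.a z₁) (R.a z₂)) : t ∈ Set.uIcc t₁ t₂ := by
  have hs : Set.uIcc t₁ t₂ ⊆ Set.Icc 0 1 := Set.uIcc_subset_Icc ht₁ ht₂
  refine mem_of_inter_nonempty hs ht htx hne hu ?_
  rw [Set.inter_comm]
  refine h.inter_nonempty (fun _ ↦ snd_nonpos_of_mem_strings) ?_
    (joinedIn_strings hl' hy hw (anchor_mem_string _) (anchor_mem_string _)) ?_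
  · rintro p (hp | hp)
    · exact snd_nonpos_of_mem_strings hp
    · exact snd_nonpos_of_mem_string (gam_image_subset_string hs hp)
  · have h₁ := joinedIn_strings hl₁ hz₁ hc₁ (anchor_mem_string _) htc₁
    have h₂ := joinedIn_strings hl₂ hz₂ hc₂ (anchor_mem_string _) htc₂
    refine ((h₁.mono ?_).trans ((joinedIn_gam_image u ht₁ ht₂).mono
      Set.subset_union_right)).trans (h₂.mono ?_).symm
    · rintro p ⟨v, hv, hp⟩
      exact .inl ⟨v, List.mem_append_left _ hv, hp⟩
    · rintro p ⟨v, hv, hp⟩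
      exact .inl ⟨v, List.mem_append_right _ hv, hp⟩

theorem exists_param_of_adj {u v : V} (h : G.Adj u v) :
    ∃ t ∈ Set.Icc (0 : ℝ) 1, R.gam u t ∈ R.string v := by
  obtain ⟨_, ⟨t, ht, rfl⟩, hv⟩ := exists_mem_string_of_adj (R := R) h
  exact ⟨t, ht, hv⟩

theorem param_ne {u v w : V} {s t : ℝ} (hvw : v ≠ w) (h : ¬ G.Adj v w)
    (hs : R.gam u s ∈ R.string v) (ht : R.gam u t ∈ R.string w) : s ≠ t := by
  rintro rfl
  exact h (adj_of_mem_string hvw hs ht)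

end Grounded1StringRep

theorem mem_MShape_iff {p q h w : ℝ} (hh : 0 < h) (hw : 0 < w) (x y : ℝ) :
    (x, y) ∈ MShape p q h w ↔
      (x = p ∧ q ≤ y ∧ y ≤ q + h) ∨ (y = q ∧ p ≤ x ∧ x ≤ p + w) := by
  rw [MShape, Set.mem_union, ← Prod.image_mk_segment_right, ← Prod.image_mk_segment_left,
    segment_eq_Icc (by linarith), segment_eq_Icc (by linarith)]
  simp only [Set.mem_image, Set.mem_Icc, Prod.mk.injEq]
  grind

/-- Two L-shapes with bends on the antidiagonal meet iff the horizontal segment of the left one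
reaches the vertical segment of the right one. -/
theorem MShape_inter_nonempty_iff {s t h h' w w' : ℝ} (hst : s < t) (hh : 0 < h) (hh' : 0 < h')
    (hw : 0 < w) (hw' : 0 < w') :
    (MShape s (-s) h w ∩ MShape t (-t) h' w').Nonempty ↔ t ≤ s + w ∧ t ≤ s + h' := by
  constructor
  · rintro ⟨⟨x, y⟩, h₁, h₂⟩
    rw [mem_MShape_iff hh hw] at h₁
    rw [mem_MShape_iff hh' hw'] at h₂
    rcases h₁ with ⟨h₁, h₁', h₁''⟩ | ⟨h₁, h₁', h₁''⟩ <;>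
      rcases h₂ with ⟨h₂, h₂', h₂''⟩ | ⟨h₂, h₂', h₂''⟩ <;> constructor <;> linarith
  · rintro ⟨h₁, h₂⟩
    refine ⟨(t, -s), ?_, ?_⟩
    · rw [mem_MShape_iff hh hw]
      exact .inr ⟨rfl, hst.le, h₁⟩
    · rw [mem_MShape_iff hh' hw']
      exact .inl ⟨rfl, by linarith, by linarith⟩

/-- The graph on `Fin n` in which `u < v` are adjacent iff `v` is at most `r u` and `u` is at least
`l v`. -/
def reachGraph {n : ℕ} (l r : Fin n → Fin n) : SimpleGraph (Fin n) where
  Adj u v := u ≠ v ∧ max u v ≤ r (min u v) ∧ l (max u v) ≤ min u v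
  symm := ⟨fun u v h ↦ by rwa [max_comm, min_comm, ne_comm]⟩
  loopless := ⟨fun _ h ↦ h.1 rfl⟩

instance {n : ℕ} (l r : Fin n → Fin n) : DecidableRel (reachGraph l r).Adj :=
  fun u v ↦ inferInstanceAs (Decidable (u ≠ v ∧ _))

theorem natCast_ne_add_half (m n : ℕ) : (m : ℝ) ≠ n + 1 / 2 := by
  intro h
  have : ((2 * m : ℕ) : ℝ) = (2 * n + 1 : ℕ) := by push_cast; linarith
  have : 2 * m = 2 * n + 1 := by exact_mod_cast this
  omega

theorem natCast_le_add_half_iff (m n : ℕ) : (m : ℝ) ≤ n + 1 / 2 ↔ m ≤ n := by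
  constructor
  · intro h
    have : (m : ℝ) < (n + 1 : ℕ) := by push_cast; linarith
    have : m < n + 1 := by exact_mod_cast this
    omega
  · intro h
    have : (m : ℝ) ≤ n := by exact_mod_cast h
    linarith

/-- Reach graphs have monotone L-representations. -/
theorem nonempty_mptRep_reachGraph {n : ℕ} {l r : Fin n → Fin n} (hl : ∀ v, l v ≤ v)
    (hr : ∀ v, v ≤ r v) : Nonempty (MptRep (reachGraph l r)) := by
  have hht (v : Fin n) : (0 : ℝ) < (v : ℕ) - (l v : ℕ) + 1 / 2 := by
    have : ((l v : ℕ) : ℝ) ≤ (v : ℕ) := by exact_mod_cast hl v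
    linarith
  have hwd (v : Fin n) : (0 : ℝ) < (r v : ℕ) - (v : ℕ) + 1 / 2 := by
    have : ((v : ℕ) : ℝ) ≤ (r v : ℕ) := by exact_mod_cast hr v
    linarith
  have hinj : Function.Injective fun v : Fin n ↦ ((v : ℕ) : ℝ) :=
    Nat.cast_injective.comp Fin.val_injective
  refine ⟨{
    p := fun v ↦ (v : ℕ)
    q := fun v ↦ -(v : ℕ)
    ht := fun v ↦ (v : ℕ) - (l v : ℕ) + 1 / 2
    wd := fun v ↦ (r v : ℕ) - (v : ℕ) + 1 / 2
    ht_pos := hht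
    wd_pos := hwd
    line := ⟨-1, 0, by norm_num, fun v ↦ by ring⟩
    p_inj := hinj
    endpoints_off := fun u v huv ↦ ?_
    adj_iff := fun u v huv ↦ ?_ }⟩
  · have hne : ((v : ℕ) : ℝ) ≠ (u : ℕ) := fun h ↦ huv (hinj h).symm
    rw [mem_MShape_iff (hht u) (hwd u), mem_MShape_iff (hht u) (hwd u)]
    constructor
    · rintro (⟨h, -⟩ | ⟨h, -⟩)
      · exact hne h
      · exact natCast_ne_add_half (l v) u (by linarith)
    · rintro (⟨h, -⟩ | ⟨h, -⟩)
      · exact natCast_ne_add_half u (r v) (by linarith)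
      · exact hne (by linarith)
  · wlog h : u < v generalizing u v
    · rw [SimpleGraph.adj_comm, Set.inter_comm]
      exact this v u huv.symm (lt_of_le_of_ne (not_lt.1 h) huv.symm)
    rw [MShape_inter_nonempty_iff (by exact_mod_cast h) (hht u) (hht v) (hwd u) (hwd v)]
    simp only [reachGraph, max_eq_right h.le, min_eq_left h.le, ne_eq, huv, not_false_eq_true,
      true_and, Fin.le_def]
    rw [← natCast_le_add_half_iff v, ← natCast_le_add_half_iff (l v)]
    refine and_congr ?_ ?_ <;> constructor <;> intro _ <;> linarith

/-- The separating graph. The vertices `0, 1, 3, 4, 6, 7, 9, 10, 12, 13, 15, 16` form a cycle, in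
this order; the vertex `8` is adjacent to `2, 5, 11, 14` (and to `7, 9`), which attach to the cycle
at `3`; `6, 16`; `10, 0`; and `13`, and the vertices `5` and `11` are adjacent. -/
def separatingGraph : SimpleGraph (Fin 17) :=
  reachGraph ![0, 0, 2, 1, 3, 5, 4, 6, 2, 7, 9, 0, 10, 12, 8, 13, 0]
    ![16, 3, 8, 4, 6, 16, 7, 9, 14, 10, 12, 11, 13, 15, 14, 16, 16]

instance : DecidableRel separatingGraph.Adj :=
  inferInstanceAs (DecidableRel (reachGraph _ _).Adj)

theorem isEmpty_grounded1StringRep_separatingGraph :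
    IsEmpty (Grounded1StringRep separatingGraph) := by
  refine ⟨fun R ↦ ?_⟩
  have ne {u v : Fin 17} (h : u ≠ v) : R.a u ≠ R.a v := R.a_inj.ne h
  have h₁ : Interleave (R.a 6) (R.a 16) (R.a 3) (R.a 8) :=
    .of_not (ne (by decide)) (ne (by decide)) (ne (by decide)) (ne (by decide)) (ne (by decide))
      (ne (by decide))
      (R.not_interleave (l := [6, 4, 3]) (l' := [16, 15, 13, 12, 10, 9, 8]) (by decide)
        (by decide) (by decide) rfl rfl rfl rfl)
      (R.not_interleave (l := [6, 7, 8]) (l' := [16, 0, 1, 3]) (by decide)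
        (by decide) (by decide) rfl rfl rfl rfl)
  have h₂ : Interleave (R.a 6) (R.a 16) (R.a 3) (R.a 13) :=
    .of_not (ne (by decide)) (ne (by decide)) (ne (by decide)) (ne (by decide)) (ne (by decide))
      (ne (by decide))
      (R.not_interleave (l := [6, 4, 3]) (l' := [16, 15, 13]) (by decide)
        (by decide) (by decide) rfl rfl rfl rfl)
      (R.not_interleave (l := [6, 7, 9, 10, 12, 13]) (l' := [16, 0, 1, 3]) (by decide)
        (by decide) (by decide) rfl rfl rfl rfl)
  have h₃ : Interleave (R.a 10) (R.a 0) (R.a 13) (R.a 8) :=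
    .of_not (ne (by decide)) (ne (by decide)) (ne (by decide)) (ne (by decide)) (ne (by decide))
      (ne (by decide))
      (R.not_interleave (l := [10, 12, 13]) (l' := [0, 1, 3, 4, 6, 7, 8]) (by decide)
        (by decide) (by decide) rfl rfl rfl rfl)
      (R.not_interleave (l := [10, 9, 8]) (l' := [0, 16, 15, 13]) (by decide)
        (by decide) (by decide) rfl rfl rfl rfl)
  have h₄ : Interleave (R.a 10) (R.a 0) (R.a 13) (R.a 3) :=
    .of_not (ne (by decide)) (ne (by decide)) (ne (by decide)) (ne (by decide)) (ne (by decide))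
      (ne (by decide))
      (R.not_interleave (l := [10, 12, 13]) (l' := [0, 1, 3]) (by decide)
        (by decide) (by decide) rfl rfl rfl rfl)
      (R.not_interleave (l := [10, 9, 7, 6, 4, 3]) (l' := [0, 16, 15, 13]) (by decide)
        (by decide) (by decide) rfl rfl rfl rfl)
  obtain ⟨ta, hta, hta'⟩ := R.exists_param_of_adj (u := 8) (v := 5) (by decide)
  obtain ⟨tb, htb, htb'⟩ := R.exists_param_of_adj (u := 8) (v := 11) (by decide)
  obtain ⟨tp, htp, htp'⟩ := R.exists_param_of_adj (u := 8) (v := 2) (by decide)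
  obtain ⟨tk, htk, htk'⟩ := R.exists_param_of_adj (u := 8) (v := 14) (by decide)
  have hap : ta ≤ tp := R.le_of_interleave (l := [3, 2]) (l' := [6, 5, 16])
    (by decide) (by decide) rfl rfl rfl rfl (by decide) (by decide) hta hta' htp htp' h₁
  have hbk : tb ≤ tk := R.le_of_interleave (l := [13, 14]) (l' := [10, 11, 0])
    (by decide) (by decide) rfl rfl rfl rfl (by decide) (by decide) htb htb' htk htk' h₃
  have ha : ta ∈ Set.uIcc tp tk := R.mem_uIcc_of_interleave (l₁ := [3, 2]) (l₂ := [13, 14])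
    (l' := [6, 5, 16]) (by decide) (by decide) (by decide) rfl rfl rfl rfl rfl rfl (by decide)
    (by decide) hta hta' htp htp' htk htk' h₂
  have hb : tb ∈ Set.uIcc tk tp := R.mem_uIcc_of_interleave (l₁ := [13, 14]) (l₂ := [3, 2])
    (l' := [10, 11, 0]) (by decide) (by decide) (by decide) rfl rfl rfl rfl rfl rfl (by decide)
    (by decide) htb htb' htk htk' htp htp' h₄
  have hap' : ta < tp := hap.lt_of_ne (R.param_ne (by decide) (by decide) hta' htp')
  have hbk' : tb < tk := hbk.lt_of_ne (R.param_ne (by decide) (by decide) htb' htk')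
  rw [Set.mem_uIcc] at ha hb
  rcases ha with ha | ha <;> rcases hb with hb | hb <;> linarith [ha.1, ha.2, hb.1, hb.2]

/-- Some finite simple graph admits a monotone L-representation
(Mpt representation) but no grounded 1-string representation. -/
theorem exists_mpt_not_grounded1String :
    ∃ (n : ℕ) (G : SimpleGraph (Fin n)),
      Nonempty (MptRep G) ∧ IsEmpty (Grounded1StringRep G) :=
  ⟨17, separatingGraph, nonempty_mptRep_reachGraph (by decide) (by decide),
    isEmpty_grounded1StringRep_separatingGraph⟩
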